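/- Let P be a coherent₁ collection of marginal previsions on a linear space 𝓛 of real-valued functions on Ω containing all constant functions, let ℬ = {B ⊆ Ω : 1_B ∈ 𝓛 and P(B) > 0} ∪ {Ω}, and assume X·1_B ∈ 𝓛 for every X ∈ 𝓛 and B ∈ ℬ. Define L(X|B) = P(X·1_B)/P(B) for all X ∈ 𝓛 and B ∈ ℬ (with the quotient equal to the infinite value of the same sign as the numerator when the numerator is infinite). Then L(·|·) is a finitely additive conditional expectation. -/

import Mathlib

open scoped BigOperators

noncomputable section

/-- The indicator function of an event `B`, as a real-valued random variable. -/
def indicatorRV {Ω : Type*} (B : Set Ω) : Ω → ℝ := B.indicator fun _ => 1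

/-- De Finetti-style coherence₁ for a collection of conditional previsions
`P (X i | B i)`, allowing infinite previsions.  For every finite subcollection,
all real coefficients `α j` (nonnegative where the prevision is `⊤`, nonpositive
where it is `⊥`), and all real prices `c j` that agree with the prevision wherever
it is finite, the resulting acceptable gamble has nonnegative supremum. -/
def Coherent1 {Ω I : Type*} (X : I → Ω → ℝ) (B : I → Set Ω) (P : I → EReal) : Prop :=
  ∀ (n : ℕ) (idx : Fin n → I) (α c : Fin n → ℝ),
    (∀ j, P (idx j) = ⊤ → 0 ≤ α j) →
    (∀ j, P (idx j) = ⊥ → α j ≤ 0) →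
    (∀ j, P (idx j) ≠ ⊤ → P (idx j) ≠ ⊥ → (c j : EReal) = P (idx j)) →
    0 ≤ ⨆ ω, ((∑ j, α j * indicatorRV (B (idx j)) ω * (X (idx j) ω - c j) : ℝ) : EReal)


/-- A stake `a` at the real price `x` is acceptable for the prevision `p` if one buys at a price
not above `p` or sells at a price not below `p`. -/
def AcceptableStake (p : EReal) (a x : ℝ) : Prop :=
  (0 ≤ a ∧ (x : EReal) ≤ p) ∨ (a ≤ 0 ∧ p ≤ (x : EReal))

lemma AcceptableStake.of_coe_eq {p : EReal} {x : ℝ} (a : ℝ) (h : (x : EReal) = p) :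
    AcceptableStake p a x :=
  (le_total 0 a).imp (fun ha => ⟨ha, h.le⟩) fun ha => ⟨ha, h.ge⟩

lemma AcceptableStake.of_coherent {p : EReal} {a x : ℝ} (htop : p = ⊤ → 0 ≤ a)
    (hbot : p = ⊥ → a ≤ 0) (hfin : p ≠ ⊤ → p ≠ ⊥ → (x : EReal) = p) :
    AcceptableStake p a x := by
  by_cases h1 : p = ⊤
  · exact .inl ⟨htop h1, h1 ▸ le_top⟩
  by_cases h2 : p = ⊥
  · exact .inr ⟨hbot h2, h2 ▸ bot_le⟩
  exact .of_coe_eq a (hfin h1 h2)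

lemma exists_acceptableStake_of_lt {p : EReal} {a : ℝ} {t : EReal} (h : t < (a : EReal) * p) :
    ∃ x : ℝ, AcceptableStake p a x ∧ t ≤ ((a * x : ℝ) : EReal) := by
  obtain ⟨r, htr, hr⟩ := EReal.lt_iff_exists_real_btwn.1 h
  suffices ∃ x : ℝ, AcceptableStake p a x ∧ r ≤ a * x by
    obtain ⟨x, hx, hrx⟩ := this
    exact ⟨x, hx, htr.le.trans (EReal.coe_le_coe_iff.2 hrx)⟩
  rcases lt_trichotomy a 0 with ha | rfl | ha
  · induction p with
    | bot => exact ⟨r / a, .inr ⟨ha.le, bot_le⟩, (mul_div_cancel₀ r ha.ne).ge⟩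
    | top => simp [EReal.coe_mul_top_of_neg ha] at hr
    | coe p => exact ⟨p, .of_coe_eq a rfl, by exact_mod_cast hr.le⟩
  · have hr0 : r ≤ 0 := by
      rw [EReal.coe_zero, zero_mul] at hr
      exact_mod_cast hr.le
    rcases le_total ((0 : ℝ) : EReal) p with hp | hp
    · exact ⟨0, .inl ⟨le_rfl, hp⟩, by simpa using hr0⟩
    · exact ⟨0, .inr ⟨le_rfl, hp⟩, by simpa using hr0⟩
  · induction p with
    | top => exact ⟨r / a, .inl ⟨ha.le, le_top⟩, (mul_div_cancel₀ r ha.ne').ge⟩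
    | bot => simp [EReal.coe_mul_bot_of_pos ha] at hr
    | coe p => exact ⟨p, .of_coe_eq a rfl, by exact_mod_cast hr.le⟩

section Marginal

variable {Ω : Type*} {L : Set (Ω → ℝ)} {P : (Ω → ℝ) → EReal}

/-- Coherence rules out a sure loss from any finite family of acceptable stakes. -/
lemma Coherent1.not_sure_loss
    (hP : Coherent1 (fun f : L => (f : Ω → ℝ)) (fun _ => (Set.univ : Set Ω)) (fun f => P f))
    {n : ℕ} (f : Fin n → L) (α c : Fin n → ℝ)
    (h : ∀ j, AcceptableStake (P (f j)) (α j) (c j)) {δ : ℝ} (hδ : δ < 0) :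
    ¬ ∀ ω, ∑ j, α j * ((f j : Ω → ℝ) ω - c j) ≤ δ := by
  classical
  intro hloss
  let c' : Fin n → ℝ := fun j =>
    if P (f j) = ⊤ ∨ P (f j) = ⊥ then c j else (P (f j)).toReal
  have hc' : ∀ j, P (f j) ≠ ⊤ → P (f j) ≠ ⊥ → (c' j : EReal) = P (f j) := fun j h1 h2 => by
    simp only [c', h1, h2, or_self, if_false]
    exact EReal.coe_toReal h1 h2
  have hcc : ∀ j, α j * c j ≤ α j * c' j := fun j => by
    by_cases hj : P (f j) = ⊤ ∨ P (f j) = ⊥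
    · simp [c', hj]
    · rw [not_or] at hj
      have hcj := hc' j hj.1 hj.2
      rcases h j with ⟨ha, hx⟩ | ⟨ha, hx⟩ <;> rw [← hcj] at hx
      · exact mul_le_mul_of_nonneg_left (EReal.coe_le_coe_iff.1 hx) ha
      · exact mul_le_mul_of_nonpos_left (EReal.coe_le_coe_iff.1 hx) ha
  have key := hP n f α c'
    (fun j hj => by
      rcases h j with ⟨ha, -⟩ | ⟨-, hx⟩
      · exact ha
      · exact absurd (top_le_iff.1 (hj.ge.trans hx)) (EReal.coe_ne_top _))
    (fun j hj => by
      rcases h j with ⟨-, hx⟩ | ⟨ha, -⟩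
      · exact absurd (le_bot_iff.1 (hx.trans hj.le)) (EReal.coe_ne_bot _)
      · exact ha)
    hc'
  refine (key.trans (iSup_le fun ω => EReal.coe_le_coe_iff.2 (le_trans ?_ (hloss ω)))).not_gt
    (by exact_mod_cast hδ)
  refine Finset.sum_le_sum fun j _ => ?_
  have := hcc j
  simp only [indicatorRV, Set.indicator_univ, mul_one]
  linarith

lemma Coherent1.le_of_combination_le
    (hP : Coherent1 (fun f : L => (f : Ω → ℝ)) (fun _ => (Set.univ : Set Ω)) (fun f => P f))
    {X Y Z : Ω → ℝ} (hX : X ∈ L) (hY : Y ∈ L) (hZ : Z ∈ L) {a b x y k : ℝ}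
    (hx : AcceptableStake (P X) a x) (hy : AcceptableStake (P Y) b y)
    (h : ∀ ω, a * X ω + b * Y ω + k ≤ Z ω) :
    ((a * x + b * y + k : ℝ) : EReal) ≤ P Z := by
  by_contra! hlt
  obtain ⟨z, hz, hzlt⟩ := EReal.lt_iff_exists_real_btwn.1 hlt
  have hzlt' := EReal.coe_lt_coe_iff.1 hzlt
  refine hP.not_sure_loss ![⟨X, hX⟩, ⟨Y, hY⟩, ⟨Z, hZ⟩] ![a, b, -1] ![x, y, z] ?_
    (sub_neg.2 hzlt') ?_
  · intro j
    fin_cases j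
    · exact hx
    · exact hy
    · exact .inr ⟨by norm_num, hz.le⟩
  · intro ω
    have := h ω
    simp only [Fin.sum_univ_three, Matrix.cons_val]
    linarith

lemma Coherent1.combination_le
    (hP : Coherent1 (fun f : L => (f : Ω → ℝ)) (fun _ => (Set.univ : Set Ω)) (fun f => P f))
    {X Y Z : Ω → ℝ} (hX : X ∈ L) (hY : Y ∈ L) (hZ : Z ∈ L) {a b : ℝ}
    (h : ∀ ω, a * X ω + b * Y ω ≤ Z ω) :
    (a : EReal) * P X + (b : EReal) * P Y ≤ P Z := by
  refine EReal.add_le_of_forall_lt fun s hs t ht => ?_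
  obtain ⟨x, hx, hsx⟩ := exists_acceptableStake_of_lt hs
  obtain ⟨y, hy, hty⟩ := exists_acceptableStake_of_lt ht
  have := hP.le_of_combination_le hX hY hZ hx hy (k := 0) (by simpa using h)
  rw [add_zero, EReal.coe_add] at this
  exact (add_le_add hsx hty).trans this

lemma Coherent1.mono
    (hP : Coherent1 (fun f : L => (f : Ω → ℝ)) (fun _ => (Set.univ : Set Ω)) (fun f => P f))
    {X Y : Ω → ℝ} (hX : X ∈ L) (hY : Y ∈ L) (h : ∀ ω, X ω ≤ Y ω) : P X ≤ P Y := by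
  simpa using hP.combination_le hX hX hY (a := 1) (b := 0) (by simpa using h)

lemma Coherent1.map_neg
    (hP : Coherent1 (fun f : L => (f : Ω → ℝ)) (fun _ => (Set.univ : Set Ω)) (fun f => P f))
    {X Y : Ω → ℝ} (hX : X ∈ L) (hY : Y ∈ L) (h : ∀ ω, Y ω = -X ω) : P Y = -P X := by
  refine le_antisymm ?_ ?_
  · by_contra! hlt
    obtain ⟨r, hXr, hr⟩ := EReal.lt_iff_exists_real_btwn.1 hlt
    obtain ⟨s, hrs, hs⟩ := EReal.lt_iff_exists_real_btwn.1 hr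
    refine hP.not_sure_loss ![⟨X, hX⟩, ⟨Y, hY⟩] ![1, 1] ![-r, s] ?_
      (sub_neg.2 (EReal.coe_lt_coe_iff.1 hrs)) fun ω => ?_
    · intro j
      fin_cases j
      · exact .inl ⟨zero_le_one, by simpa using EReal.neg_le_of_neg_le hXr.le⟩
      · exact .inl ⟨zero_le_one, hs.le⟩
    · have := h ω
      simp only [Fin.sum_univ_two, Matrix.cons_val]
      linarith
  · simpa using hP.combination_le hX hX hY (a := -1) (b := 0) (by simp [h])

lemma Coherent1.map_const
    (hP : Coherent1 (fun f : L => (f : Ω → ℝ)) (fun _ => (Set.univ : Set Ω)) (fun f => P f))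
    (hconst : ∀ c : ℝ, (fun _ => c) ∈ L) (c : ℝ) : P (fun _ => c) = (c : EReal) := by
  have hle : ∀ k : ℝ, (k : EReal) ≤ P (fun _ => k) := fun k => by
    have hs : AcceptableStake (P (fun _ => k)) 0 0 :=
      (le_total _ _).imp (fun h => ⟨le_rfl, h⟩) fun h => ⟨le_rfl, h⟩
    simpa using hP.le_of_combination_le (hconst k) (hconst k) (hconst k) hs hs (k := k) (by simp)
  refine le_antisymm ?_ (hle c)
  have hneg := hle (-c)
  rw [hP.map_neg (hconst c) (hconst (-c)) fun _ => rfl, EReal.coe_neg] at hneg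
  exact EReal.neg_le_neg_iff.1 hneg

lemma Coherent1.map_combination
    (hP : Coherent1 (fun f : L => (f : Ω → ℝ)) (fun _ => (Set.univ : Set Ω)) (fun f => P f))
    (hsmul : ∀ (a : ℝ), ∀ X ∈ L, (fun ω => a * X ω) ∈ L)
    {X Y Z : Ω → ℝ} (hX : X ∈ L) (hY : Y ∈ L) (hZ : Z ∈ L) {a b : ℝ}
    (h : ∀ ω, Z ω = a * X ω + b * Y ω)
    (hdef : ¬(((a : EReal) * P X = ⊤ ∧ (b : EReal) * P Y = ⊥) ∨
      ((a : EReal) * P X = ⊥ ∧ (b : EReal) * P Y = ⊤))) :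
    P Z = (a : EReal) * P X + (b : EReal) * P Y := by
  refine le_antisymm ?_ (hP.combination_le hX hY hZ fun ω => (h ω).ge)
  have hZ' := hsmul (-1) Z hZ
  have hle := hP.combination_le hX hY hZ' (a := -a) (b := -b) fun ω => by
    rw [h ω]; linarith
  rw [hP.map_neg hZ hZ' fun ω => by ring, EReal.coe_neg, EReal.coe_neg, EReal.neg_mul,
    EReal.neg_mul, ← sub_eq_add_neg, ← EReal.neg_add (by tauto) (by tauto)] at hle
  exact EReal.neg_le_neg_iff.1 hle

lemma Coherent1.map_smul
    (hP : Coherent1 (fun f : L => (f : Ω → ℝ)) (fun _ => (Set.univ : Set Ω)) (fun f => P f))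
    (hsmul : ∀ (a : ℝ), ∀ X ∈ L, (fun ω => a * X ω) ∈ L)
    {X : Ω → ℝ} (hX : X ∈ L) (a : ℝ) : P (fun ω => a * X ω) = (a : EReal) * P X := by
  simpa using hP.map_combination hsmul hX hX (hsmul a X hX) (a := a) (b := 0) (by simp) (by simp)

lemma Coherent1.sum_nonneg
    (hP : Coherent1 (fun f : L => (f : Ω → ℝ)) (fun _ => (Set.univ : Set Ω)) (fun f => P f))
    (hconst : ∀ c : ℝ, (fun _ => c) ∈ L)
    (hadd : ∀ X ∈ L, ∀ Y ∈ L, (fun ω => X ω + Y ω) ∈ L)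
    {ι : Type*} (s : Finset ι) (Z : ι → Ω → ℝ) (hZ : ∀ i ∈ s, Z i ∈ L)
    (h : ∀ i ∈ s, 0 ≤ P (Z i)) :
    (fun ω => ∑ i ∈ s, Z i ω) ∈ L ∧ 0 ≤ P (fun ω => ∑ i ∈ s, Z i ω) := by
  classical
  induction s using Finset.induction_on with
  | empty => exact ⟨by simpa using hconst 0, by simp [hP.map_const hconst]⟩
  | insert i s hi ih =>
    obtain ⟨hmem, hnn⟩ := ih (fun j hj => hZ j (Finset.mem_insert_of_mem hj))
      fun j hj => h j (Finset.mem_insert_of_mem hj)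
    have hZi := hZ i (Finset.mem_insert_self i s)
    have hsum := hadd _ hZi _ hmem
    simp only [Finset.sum_insert hi]
    refine ⟨hsum, (add_nonneg (h i (Finset.mem_insert_self i s)) hnn).trans ?_⟩
    simpa using hP.combination_le hZi hmem hsum (a := 1) (b := 1) (by simp)

end Marginal

lemma indicatorRV_le_one {Ω : Type*} (B : Set Ω) (ω : Ω) : indicatorRV B ω ≤ 1 :=
  Set.indicator_le_self' (fun _ _ => zero_le_one) ω

lemma indicatorRV_mul_self {Ω : Type*} (B : Set Ω) (ω : Ω) :
    indicatorRV B ω * indicatorRV B ω = indicatorRV B ω := by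
  by_cases h : ω ∈ B <;> simp [indicatorRV, h]

/-- Let `P` be a coherent₁ marginal prevision on a linear space `L` containing all
constants, let `Bc` consist of `Ω` together with the events of positive prevision
whose indicators lie in `L`, and assume `L` is closed under multiplication by the
indicator of any member of `Bc`.  Then `Lc X B = P (X·1_B) / P (1_B)` defines a
finitely additive conditional expectation:  each member of `Bc` is nonempty; for each
`B ∈ Bc`, `Lc (·|B)` is a finitely additive expectation on `L` (normalized, monotone,
and extended-linear where well defined) with `Lc (X·1_B|B) = Lc (X|B)`; and the whole
collection `{Lc (X|B) : X ∈ L, B ∈ Bc}` is a coherent₁ conditional prevision. -/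
theorem conditional_expectation_of_pos_prob {Ω : Type*} [Nonempty Ω]
    (L : Set (Ω → ℝ))
    (hconst : ∀ c : ℝ, (fun _ => c) ∈ L)
    (hadd : ∀ X ∈ L, ∀ Y ∈ L, (fun ω => X ω + Y ω) ∈ L)
    (hsmul : ∀ (a : ℝ), ∀ X ∈ L, (fun ω => a * X ω) ∈ L)
    (P : (Ω → ℝ) → EReal)
    (hP : Coherent1 (fun f : L => (f : Ω → ℝ)) (fun _ => (Set.univ : Set Ω))
      (fun f => P f))
    (Bc : Set (Set Ω))
    (hBc : Bc = {B : Set Ω | indicatorRV B ∈ L ∧ 0 < P (indicatorRV B)} ∪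
      {(Set.univ : Set Ω)})
    (hclosed : ∀ X ∈ L, ∀ B ∈ Bc, (fun ω => X ω * indicatorRV B ω) ∈ L)
    (Lc : (Ω → ℝ) → Set Ω → EReal)
    (hLc : ∀ (X : Ω → ℝ) (B : Set Ω),
      Lc X B = P (fun ω => X ω * indicatorRV B ω) / P (indicatorRV B)) :
    (∀ B ∈ Bc, B.Nonempty) ∧
    (∀ B ∈ Bc, Lc (fun _ => 1) B = 1) ∧
    (∀ B ∈ Bc, ∀ X ∈ L, ∀ Y ∈ L, (∀ ω, X ω ≤ Y ω) → Lc X B ≤ Lc Y B) ∧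
    (∀ B ∈ Bc, ∀ (a b : ℝ), ∀ X ∈ L, ∀ Y ∈ L,
      ¬(((a : EReal) * Lc X B = ⊤ ∧ (b : EReal) * Lc Y B = ⊥) ∨
        ((a : EReal) * Lc X B = ⊥ ∧ (b : EReal) * Lc Y B = ⊤)) →
      Lc (fun ω => a * X ω + b * Y ω) B = (a : EReal) * Lc X B + (b : EReal) * Lc Y B) ∧
    (∀ B ∈ Bc, ∀ X ∈ L, Lc (fun ω => X ω * indicatorRV B ω) B = Lc X B) ∧
    Coherent1 (fun i : {p : (Ω → ℝ) × Set Ω // p.1 ∈ L ∧ p.2 ∈ Bc} => i.1.1)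
      (fun i => i.1.2) (fun i => Lc i.1.1 i.1.2) := by
  have hB : ∀ B ∈ Bc, indicatorRV B ∈ L ∧
      ∃ p : ℝ, 0 < p ∧ P (indicatorRV B) = (p : EReal) := by
    intro B hB
    rw [hBc] at hB
    rcases hB with ⟨hBL, hpos⟩ | hB
    · have hle : P (indicatorRV B) ≤ ((1 : ℝ) : EReal) :=
        hP.map_const hconst 1 ▸ hP.mono hBL (hconst 1) (indicatorRV_le_one B)
      have hcoe := EReal.coe_toReal (ne_top_of_le_ne_top (EReal.coe_ne_top 1) hle)
        (EReal.bot_lt_zero.trans hpos).ne'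
      refine ⟨hBL, _, ?_, hcoe.symm⟩
      rw [← hcoe] at hpos
      exact_mod_cast hpos
    · have huniv : indicatorRV B = fun _ => (1 : ℝ) := by
        rw [Set.mem_singleton_iff.1 hB]
        exact Set.indicator_univ _
      rw [huniv]
      exact ⟨hconst 1, 1, one_pos, hP.map_const hconst 1⟩
  have hrep : ∀ B ∈ Bc, ∃ q : ℝ, 0 < q ∧ P (indicatorRV B) = ((q⁻¹ : ℝ) : EReal) ∧
      ∀ X ∈ L, (fun ω => q * (X ω * indicatorRV B ω)) ∈ L ∧
        Lc X B = P (fun ω => q * (X ω * indicatorRV B ω)) := by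
    intro B hBm
    obtain ⟨-, p, hp, hPp⟩ := hB B hBm
    refine ⟨p⁻¹, inv_pos.2 hp, by rw [inv_inv, hPp], fun X hX => ?_⟩
    have hXB := hclosed X hX B hBm
    refine ⟨hsmul _ _ hXB, ?_⟩
    rw [hLc, hPp, hP.map_smul hsmul hXB, EReal.coe_inv, EReal.div_eq_inv_mul]
  refine ⟨?_, ?_, ?_, ?_, ?_, ?_⟩
  · intro B hBm
    obtain ⟨-, p, hp, hPp⟩ := hB B hBm
    by_contra hne
    have hzero : indicatorRV B = fun _ => (0 : ℝ) := by
      rw [Set.not_nonempty_iff_eq_empty.1 hne]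
      exact Set.indicator_empty _
    rw [hzero, hP.map_const hconst] at hPp
    exact hp.ne (EReal.coe_injective hPp)
  · intro B hBm
    obtain ⟨-, p, hp, hPp⟩ := hB B hBm
    rw [hLc]
    simp only [one_mul]
    change P (indicatorRV B) / P (indicatorRV B) = 1
    rw [hPp, ← EReal.coe_div, div_self hp.ne', EReal.coe_one]
  · intro B hBm X hX Y hY hXY
    obtain ⟨q, hq, -, hL⟩ := hrep B hBm
    rw [(hL X hX).2, (hL Y hY).2]
    refine hP.mono (hL X hX).1 (hL Y hY).1 fun ω => ?_
    have h0 : 0 ≤ indicatorRV B ω := Set.indicator_nonneg (fun _ _ => zero_le_one) ω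
    exact mul_le_mul_of_nonneg_left (mul_le_mul_of_nonneg_right (hXY ω) h0) hq.le
  · intro B hBm a b X hX Y hY hdef
    obtain ⟨q, hq, -, hL⟩ := hrep B hBm
    have hZ := hL _ (hadd _ (hsmul a X hX) _ (hsmul b Y hY))
    rw [(hL X hX).2, (hL Y hY).2] at hdef ⊢
    rw [hZ.2]
    exact hP.map_combination hsmul (hL X hX).1 (hL Y hY).1 hZ.1 (fun ω => by ring) hdef
  · intro B hBm X hX
    rw [hLc, hLc]
    simp only [mul_assoc, indicatorRV_mul_self]
  · intro n idx α c htop hbot hfin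
    by_contra! hlt
    obtain ⟨δ, hδ, hδ0⟩ := EReal.lt_iff_exists_real_btwn.1 hlt
    have hterm : ∀ j : Fin n,
        (fun ω => α j * indicatorRV (idx j).1.2 ω * ((idx j).1.1 ω - c j)) ∈ L ∧
        0 ≤ P (fun ω => α j * indicatorRV (idx j).1.2 ω * ((idx j).1.1 ω - c j)) := by
      intro j
      rcases hi : idx j with ⟨⟨X, B⟩, hX, hBm⟩
      have hs : AcceptableStake (Lc X B) (α j) (c j) := by
        refine .of_coherent ?_ ?_ ?_
        · simpa [hi] using htop j
        · simpa [hi] using hbot j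
        · simpa [hi] using hfin j
      obtain ⟨q, hq, hPq, hL⟩ := hrep B hBm
      have hIL := (hB B hBm).1
      rw [(hL X hX).2] at hs
      have hs' : AcceptableStake (P fun ω => q * (X ω * indicatorRV B ω)) (α j * q⁻¹) (c j) :=
        hs.imp (fun h => ⟨mul_nonneg h.1 (inv_pos.2 hq).le, h.2⟩)
          fun h => ⟨mul_nonpos_of_nonpos_of_nonneg h.1 (inv_pos.2 hq).le, h.2⟩
      have heq : ∀ ω, α j * q⁻¹ * (q * (X ω * indicatorRV B ω)) +
          -(α j * c j) * indicatorRV B ω = α j * indicatorRV B ω * (X ω - c j) := fun ω => by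
        field_simp
        ring
      have hZ : (fun ω => α j * indicatorRV B ω * (X ω - c j)) ∈ L := by
        simpa only [heq] using
          hadd _ (hsmul (α j * q⁻¹) _ (hL X hX).1) _ (hsmul (-(α j * c j)) _ hIL)
      refine ⟨hZ, ?_⟩
      have := hP.le_of_combination_le (hL X hX).1 hIL hZ hs'
        (.of_coe_eq (-(α j * c j)) hPq.symm) (k := 0) fun ω => by rw [add_zero, heq]
      convert this using 1
      rw [← EReal.coe_zero]
      congr 1
      ring
    obtain ⟨hmem, hnn⟩ := hP.sum_nonneg hconst hadd Finset.univ _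
      (fun j _ => (hterm j).1) fun j _ => (hterm j).2
    have hle := hP.mono hmem (hconst δ) fun ω =>
      EReal.coe_le_coe_iff.1 ((le_iSup (fun ω => ((∑ j, α j * indicatorRV (idx j).1.2 ω *
        ((idx j).1.1 ω - c j) : ℝ) : EReal)) ω).trans hδ.le)
    rw [hP.map_const hconst] at hle
    exact (hnn.trans hle).not_gt hδ0

end
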